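/- Let X be a real random variable taking values in an interval (a,b), where −∞ ≤ a < b ≤ ∞, with mean Υ. Let f : (a,b) → ℝ be a monotone function, and let Υ_f denote the mean of f(X). If |f(Υ) − Υ_f| > 2u > 0, then for every y ∈ ℝ the event {|f(X) − y| > u} has positive probability. -/

import Mathlib

open MeasureTheory

/-- Lemma 4.2 / `trivial_lemma`: if `X` takes values in `(a,b)`
with mean `Υ`, `f` is monotone on `(a,b)` with `E[f(X)] = Υ_f`, and
`|f(Υ) - Υ_f| > 2u > 0`, then for every `y ∈ ℝ` the event `{|f(X) - y| > u}`
has positive probability. -/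
theorem statement5
    {Ω : Type} [MeasurableSpace Ω] (P : Measure Ω) [IsProbabilityMeasure P]
    (X : Ω → ℝ) (hXint : Integrable X P)
    (a b : EReal) (hab : a < b)
    (hrange : ∀ᵐ ω ∂P, a < (X ω : EReal) ∧ (X ω : EReal) < b)
    (f : ℝ → ℝ)
    (hf : MonotoneOn f {x : ℝ | a < (x : EReal) ∧ (x : EReal) < b} ∨
          AntitoneOn f {x : ℝ | a < (x : EReal) ∧ (x : EReal) < b})
    (hfXint : Integrable (fun ω => f (X ω)) P)
    (u : ℝ) (hu : 0 < u)
    (hgap : 2 * u < |f (∫ ω, X ω ∂P) - ∫ ω, f (X ω) ∂P|) :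
    ∀ y : ℝ, 0 < P {ω | u < |f (X ω) - y|} := by
  intro y
  by_contra hcon
  have h0 : P {ω | u < |f (X ω) - y|} = 0 := by simpa using hcon
  have hbd : ∀ᵐ ω ∂P, |f (X ω) - y| ≤ u := by
    rw [ae_iff]
    simpa only [not_le] using h0
  have hgood : ∀ᵐ ω ∂P, (a < (X ω : EReal) ∧ (X ω : EReal) < b) ∧ |f (X ω) - y| ≤ u :=
    hrange.and hbd
  rw [ae_iff] at hgood
  obtain ⟨w1, hw1, hle1⟩ := exists_notMem_null_le_integral hXint hgood
  obtain ⟨w2, hw2, hle2⟩ := exists_notMem_null_integral_le hXint hgood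
  simp only [Set.mem_setOf_eq, not_not] at hw1 hw2
  obtain ⟨hr1, hb1⟩ := hw1
  obtain ⟨hr2, hb2⟩ := hw2
  have hm : a < ((∫ ω, X ω ∂P : ℝ) : EReal) ∧ ((∫ ω, X ω ∂P : ℝ) : EReal) < b :=
    ⟨hr1.1.trans_le (EReal.coe_le_coe_iff.2 hle1), (EReal.coe_le_coe_iff.2 hle2).trans_lt hr2.2⟩
  have hup : ∫ ω, f (X ω) ∂P ≤ y + u := by
    have h := integral_mono_ae hfXint (integrable_const (y + u))
      (hbd.mono fun ω h => by have := (abs_le.1 h).2; show f (X ω) ≤ y + u; linarith)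
    simpa using h
  have hlo : y - u ≤ ∫ ω, f (X ω) ∂P := by
    have h := integral_mono_ae (integrable_const (y - u)) hfXint
      (hbd.mono fun ω h => by have := (abs_le.1 h).1; show y - u ≤ f (X ω); linarith)
    simpa using h
  rw [abs_le] at hb1 hb2
  have hfin : |f (∫ ω, X ω ∂P) - ∫ ω, f (X ω) ∂P| ≤ 2 * u := by
    rw [abs_le]
    rcases hf with hf | hf
    · have h1 := hf hr1 hm hle1
      have h2 := hf hm hr2 hle2
      constructor <;> linarith [hb1.1, hb2.2]
    · have h1 := hf hr1 hm hle1
      have h2 := hf hm hr2 hle2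
      constructor <;> linarith [hb1.2, hb2.1]
  linarith
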